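/- arXiv:1710.07901 — 3 statements merged into one kernel-verified Lean document; each statement's English description precedes it below -/
import Mathlib

section
/- Let X be a separable infinite-dimensional complex Banach space and T a bounded operator on X. If T admits a bicyclic vector x₀ with associated family (xₙ)_{n∈ℤ} such that the series Σ_{n∈ℤ} x_{−n} is unconditionally convergent (i.e. the family (x_{−n})_{n∈ℤ} is summable), then T is frequently hypercyclic: there exists x ∈ X such that for every non-empty open set U ⊆ X, the set N(x,U) = {n ≥ 1 : Tⁿx ∈ U} has positive lower density. -/
open Filter Topology

/-- The proportion of elements of `A` in `[1, n]`. -/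
noncomputable def partialDensity (A : Set ℕ) (n : ℕ) : ℝ :=
  ((A ∩ Set.Icc 1 n).ncard : ℝ) / n

/-- Lower density of a set of natural numbers. -/
noncomputable def lowerDensity (A : Set ℕ) : ℝ :=
  Filter.liminf (fun N : ℕ => partialDensity A N) Filter.atTop

open scoped Nat

theorem lowerDensity_pos_of_linear_growth {S : Set ℕ} {f : ℕ → ℕ} {C : ℕ} (hf : f.Injective)
    (hS : ∀ j, f j ∈ S) (hpos : ∀ j, 1 ≤ f j) (hC : ∀ j, f j ≤ C * (j + 1)) :
    0 < lowerDensity S := by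
  have hC0 : 0 < C := by
    have h1 := hpos 0
    have h2 := hC 0
    lia
  have hcard (N : ℕ) : N / C ≤ (S ∩ Set.Icc 1 N).ncard := by
    have hsub : f '' Set.Iio (N / C) ⊆ S ∩ Set.Icc 1 N := by
      rintro _ ⟨j, hj, rfl⟩
      refine ⟨hS j, hpos j, (hC j).trans ?_⟩
      calc C * (j + 1) ≤ C * (N / C) := Nat.mul_le_mul_left _ hj
        _ ≤ N := Nat.mul_div_le N C
    have h := Set.ncard_le_ncard hsub ((Set.finite_Icc 1 N).inter_of_right S)
    rwa [Set.ncard_image_of_injective _ hf, Set.ncard_Iio_nat] at h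
  have hbdd (N : ℕ) : partialDensity S N ≤ 1 := by
    refine div_le_one_of_le₀ ?_ (Nat.cast_nonneg N)
    have h := Set.ncard_le_ncard (Set.inter_subset_right (s := S)) (Set.finite_Icc 1 N)
    rw [Set.ncard_Icc_nat] at h
    exact_mod_cast h
  have hlower : ∀ᶠ N in atTop, 1 / (2 * C : ℝ) ≤ partialDensity S N := by
    filter_upwards [eventually_ge_atTop C] with N hN
    have hN0 : 0 < N := hC0.trans_le hN
    have h1 : 1 ≤ N / C := (Nat.one_le_div_iff hC0).2 hN
    have h2 : N < C * (N / C + 1) := Nat.lt_mul_div_succ N hC0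
    have h3 : N ≤ 2 * C * (S ∩ Set.Icc 1 N).ncard := by
      calc N ≤ 2 * C * (N / C) := by nlinarith
        _ ≤ _ := Nat.mul_le_mul_left _ (hcard N)
    rw [partialDensity, div_le_div_iff₀ (by positivity) (by positivity)]
    have h4 : (N : ℝ) ≤ 2 * C * (S ∩ Set.Icc 1 N).ncard := by exact_mod_cast h3
    linarith
  have hcob : IsCoboundedUnder (· ≥ ·) atTop (partialDensity S) :=
    (isBoundedUnder_of ⟨1, hbdd⟩ : IsBoundedUnder (· ≤ ·) atTop _).isCoboundedUnder_ge
  calc (0 : ℝ) < 1 / (2 * C) := by positivity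
    _ ≤ lowerDensity S := le_liminf_of_le hcob hlower

/-- Increasing positions in `ℕ` whose successive gaps around the `n`-th one exceed the `2`-adic
valuation of `n`. -/
def spacedPosition (n : ℕ) : ℕ :=
  n + padicValNat 2 n ! + padicValNat 2 (n - 1)!

theorem spacedPosition_le (n : ℕ) : spacedPosition n ≤ 3 * n := by
  have h (m : ℕ) : padicValNat 2 m ! ≤ m := by
    have := sub_one_mul_padicValNat_factorial (p := 2) m
    lia
  have h1 := h n
  have h2 := h (n - 1)
  unfold spacedPosition
  lia

theorem spacedPosition_succ {n : ℕ} (hn : n ≠ 0) :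
    spacedPosition (n + 1) =
      spacedPosition n + 1 + padicValNat 2 n + padicValNat 2 (n + 1) := by
  obtain ⟨m, rfl⟩ := Nat.exists_eq_succ_of_ne_zero hn
  simp only [spacedPosition, Nat.succ_eq_add_one, Nat.add_sub_cancel]
  rw [Nat.factorial_succ (m + 1), padicValNat.mul (by positivity) (by positivity),
    Nat.factorial_succ m, padicValNat.mul (by positivity) (by positivity)]
  ring

theorem spacedPosition_gap {m n : ℕ} (hm : m ≠ 0) (hmn : m < n) :
    spacedPosition m + padicValNat 2 m + padicValNat 2 n < spacedPosition n := by
  induction n, hmn using Nat.le_induction with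
  | base => rw [Nat.succ_eq_add_one, spacedPosition_succ hm]; lia
  | succ n hn ih => rw [spacedPosition_succ (by lia)]; lia

/-- The positions of index having `2`-adic valuation `r`. -/
def spacedSet (r : ℕ) : Set ℕ :=
  spacedPosition '' {n | n ≠ 0 ∧ padicValNat 2 n = r}

theorem lt_of_mem_spacedSet {r n : ℕ} (hn : n ∈ spacedSet r) : r < n := by
  obtain ⟨i, ⟨hi, rfl⟩, rfl⟩ := hn
  have h1 : 2 ^ padicValNat 2 i ≤ i := Nat.le_of_dvd (by lia) pow_padicValNat_dvd
  have h2 : padicValNat 2 i < 2 ^ padicValNat 2 i := Nat.lt_two_pow_self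
  unfold spacedPosition
  lia

theorem lt_abs_sub_of_mem_spacedSet {r s m n : ℕ} (hm : m ∈ spacedSet r) (hn : n ∈ spacedSet s)
    (h : m ≠ n ∨ r ≠ s) : (r + s : ℤ) < |(m : ℤ) - n| := by
  obtain ⟨i, ⟨hi, rfl⟩, rfl⟩ := hm
  obtain ⟨j, ⟨hj, rfl⟩, rfl⟩ := hn
  rcases lt_trichotomy i j with hij | rfl | hij
  · have := spacedPosition_gap hi hij
    rw [lt_abs]
    lia
  · simp at h
  · have := spacedPosition_gap hj hij
    rw [lt_abs]
    lia

theorem lowerDensity_pos_of_spacedSet_subset {r : ℕ} {S : Set ℕ} (h : spacedSet r ⊆ S) :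
    0 < lowerDensity S := by
  have hmem (j : ℕ) : spacedPosition (2 ^ r * (2 * j + 1)) ∈ spacedSet r := by
    refine ⟨_, ⟨by positivity, ?_⟩, rfl⟩
    rw [padicValNat.mul (by positivity) (by positivity), padicValNat.prime_pow,
      padicValNat.eq_zero_of_not_dvd (by lia), add_zero]
  have hmono : StrictMono fun j ↦ spacedPosition (2 ^ r * (2 * j + 1)) := by
    intro i j hij
    have hlt : 2 ^ r * (2 * i + 1) < 2 ^ r * (2 * j + 1) := by gcongr
    have := spacedPosition_gap (by positivity) hlt
    dsimp only
    lia
  refine lowerDensity_pos_of_linear_growth (C := 6 * 2 ^ r) hmono.injective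
    (fun j ↦ h (hmem j)) (fun j ↦ ?_) fun j ↦ ?_
  · have := lt_of_mem_spacedSet (hmem j)
    lia
  · calc _ ≤ 3 * (2 ^ r * (2 * j + 1)) := spacedPosition_le _
      _ ≤ 3 * (2 ^ r * (2 * (j + 1))) := by gcongr; lia
      _ = _ := by ring

section FrequentHypercyclicity

variable {X : Type*} [NormedAddCommGroup X]

theorem eventually_norm_tsum_le {Y : ℤ → X} [CompleteSpace X] (hY : Summable Y) {ε : ℝ}
    (hε : 0 < ε) :
    ∀ᶠ N : ℕ in atTop, ∀ t : Set ℤ, (∀ j ∈ t, (N : ℤ) < |j|) → ‖∑' b : t, Y b‖ ≤ ε := by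
  obtain ⟨s, hs⟩ := hY.tsum_vanishing (Metric.closedBall_mem_nhds 0 hε)
  filter_upwards [eventually_ge_atTop (s.sup Int.natAbs)] with N hN t ht
  have := hs t (Set.disjoint_left.2 fun j hj hjs ↦ by
    have h1 := ht j hj
    have h2 : j.natAbs ≤ s.sup Int.natAbs := Finset.le_sup (f := Int.natAbs) hjs
    rw [Int.abs_eq_natAbs] at h1
    lia)
  simpa using this

variable [NormedSpace ℂ X]

theorem pow_apply_orbit {T : X →L[ℂ] X} {Y : ℤ → X} (hTY : ∀ n, T (Y n) = Y (n + 1)) (m : ℕ)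
    (j : ℤ) : (T ^ m) (Y j) = Y (m + j) := by
  induction m with
  | zero => simp
  | succ m ih =>
    rw [pow_succ', mul_apply_eq_comp, ih, hTY]
    congr 1
    push_cast
    ring

theorem exists_summable_orbit_of_mem_span {T : X →L[ℂ] X} {e : ℤ → X}
    (hTe : ∀ n, T (e n) = e (n + 1)) (hsum : Summable e) {y : X}
    (hy : y ∈ Submodule.span ℂ (Set.range e)) :
    ∃ Y : ℤ → X, Y 0 = y ∧ (∀ n, T (Y n) = Y (n + 1)) ∧ Summable Y := by
  induction hy using Submodule.span_induction with
  | mem y hy =>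
    obtain ⟨j, rfl⟩ := hy
    refine ⟨fun n ↦ e (n + j), by simp, fun n ↦ ?_, ?_⟩
    · rw [hTe, add_right_comm]
    · exact (Equiv.addRight j).summable_iff.2 hsum
  | zero => exact ⟨0, by simp, by simp, summable_zero⟩
  | add y z _ _ hy hz =>
    obtain ⟨Y, rfl, hTY, hY⟩ := hy
    obtain ⟨Z, rfl, hTZ, hZ⟩ := hz
    exact ⟨Y + Z, rfl, fun n ↦ by simp [hTY, hTZ], hY.add hZ⟩
  | smul c y _ hy =>
    obtain ⟨Y, rfl, hTY, hY⟩ := hy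
    exact ⟨c • Y, rfl, fun n ↦ by simp [hTY], hY.const_smul c⟩

/-- Summable bilateral orbits can be combined into a single vector whose iterates approximate
each of them along a set of positive lower density. -/
theorem exists_forall_norm_pow_sub_le [CompleteSpace X] (T : X →L[ℂ] X) (Y : ℕ → ℤ → X)
    (hTY : ∀ k n, T (Y k n) = Y k (n + 1)) (hY : ∀ k, Summable (Y k)) :
    ∃ (x : X) (r : ℕ → ℕ), ∀ l, ∀ m ∈ spacedSet (r l),
      ‖(T ^ m) x - Y l 0‖ ≤ 2 * (1 / 2 : ℝ) ^ l := by
  obtain ⟨r, hr, htail⟩ := extraction_forall_of_eventually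
    (P := fun k N ↦ ∀ i ∈ Set.Iic k, ∀ t : Set ℤ, (∀ j ∈ t, (N : ℤ) < |j|) →
      ‖∑' b : t, Y i b‖ ≤ (1 / 4 : ℝ) ^ k)
    fun k ↦ ((Set.finite_Iic k).eventually_all).2 fun i _ ↦
      eventually_norm_tsum_le (hY i) (by positivity)
  have hbound (k i : ℕ) (hik : i ≤ k) (m : ℕ) (A : Set ℕ)
      (hA : ∀ n ∈ A, (r k : ℤ) < |(m : ℤ) - n|) :
      ‖∑' n : A, Y i (m - (n : ℕ))‖ ≤ (1 / 4 : ℝ) ^ k := by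
    have hinj : Set.InjOn (fun n : ℕ ↦ (m : ℤ) - n) A := fun a _ b _ hab ↦ by
      dsimp only at hab
      lia
    rw [← tsum_image (Y i) hinj]
    refine htail k i hik _ ?_
    rintro _ ⟨n, hn, rfl⟩
    exact hA n hn
  have hsumm (k m : ℕ) : Summable fun n : ℕ ↦ Y k (m - n) :=
    (hY k).comp_injective fun a b hab ↦ by lia
  set G : ℕ → ℕ → X := fun k m ↦ ∑' n : spacedSet (r k), Y k (m - (n : ℕ)) with hG
  have hG0 : Summable fun k ↦ G k 0 := by
    refine Summable.of_norm_bounded (summable_geometric_of_lt_one (r := (1 / 4 : ℝ))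
      (by norm_num) (by norm_num)) fun k ↦ hbound k k le_rfl 0 _ fun n hn ↦ ?_
    have := lt_of_mem_spacedSet hn
    rw [lt_abs]
    lia
  have hTG (k m : ℕ) : (T ^ m) (G k 0) = G k m := by
    rw [hG]
    dsimp only
    have hs : Summable fun n : spacedSet (r k) ↦ Y k ((0 : ℕ) - (n : ℕ)) := (hsumm k 0).subtype _
    rw [(T ^ m).map_tsum hs]
    refine tsum_congr fun n ↦ ?_
    rw [pow_apply_orbit (hTY k)]
    congr 1
    push_cast
    ring
  have hfar (k l m : ℕ) (A : Set ℕ) (hA : ∀ n ∈ A, (r k + r l : ℤ) < |(m : ℤ) - n|) :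
      ‖∑' n : A, Y k (m - (n : ℕ))‖ ≤ (1 / 2 : ℝ) ^ l * (1 / 2) ^ k := by
    have hmax : (r (max k l) : ℤ) ≤ r k + r l := by
      rcases max_choice k l with h | h <;> rw [h] <;> lia
    calc _ ≤ (1 / 4 : ℝ) ^ max k l :=
          hbound _ k (le_max_left k l) m A fun n hn ↦ hmax.trans_lt (hA n hn)
      _ = (1 / 2 : ℝ) ^ (2 * max k l) := by rw [pow_mul]; norm_num
      _ ≤ (1 / 2 : ℝ) ^ (l + k) :=
          pow_le_pow_of_le_one (by norm_num) (by norm_num) (by lia)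
      _ = _ := pow_add _ _ _
  refine ⟨∑' k, G k 0, r, fun l m hm ↦ ?_⟩
  have hx : HasSum (fun k ↦ G k m - if k = l then Y l 0 else 0)
      ((T ^ m) (∑' k, G k 0) - Y l 0) := by
    refine HasSum.sub ?_ (hasSum_ite_eq l (Y l 0))
    simpa only [hTG] using (T ^ m).hasSum hG0.hasSum
  have hgeom : HasSum (fun k ↦ (1 / 2 : ℝ) ^ l * (1 / 2) ^ k) (2 * (1 / 2 : ℝ) ^ l) := by
    rw [mul_comm (2 : ℝ)]
    exact hasSum_geometric_two.mul_left _
  rw [← hx.tsum_eq]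
  refine tsum_of_norm_bounded hgeom fun k ↦ ?_
  by_cases hkl : k = l
  · subst hkl
    have hsplit : G k m = Y k 0 + ∑' n : (spacedSet (r k) \ {m} : Set ℕ), Y k (m - (n : ℕ)) := by
      have h := Summable.tsum_union_disjoint (f := fun n : ℕ ↦ Y k (m - n))
        (s := {m}) (t := spacedSet (r k) \ {m}) Set.disjoint_sdiff_right
        ((hsumm k m).subtype _) ((hsumm k m).subtype _)
      rw [Set.union_sdiff_cancel (Set.singleton_subset_iff.2 hm)] at h
      simpa using h
    rw [if_pos rfl, hsplit, add_sub_cancel_left]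
    exact hfar k k m _ fun n hn ↦ lt_abs_sub_of_mem_spacedSet hm hn.1 (Or.inl (Ne.symm hn.2))
  · rw [if_neg hkl, sub_zero]
    refine hfar k l m _ fun n hn ↦ ?_
    rw [add_comm]
    exact lt_abs_sub_of_mem_spacedSet hm hn (Or.inr (hr.injective.ne (Ne.symm hkl)))

end FrequentHypercyclicity

/-- If a bounded operator `T` on a separable infinite-dimensional complex Banach space admits a
bicyclic vector `x₀` (with associated family `e : ℤ → X`, `e n = Tⁿx₀`) such that the series
`∑_{n∈ℤ} T^{-n}x₀` is unconditionally convergent, then `T` is frequently hypercyclic. -/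
theorem stmt_5 {X : Type*} [NormedAddCommGroup X] [NormedSpace ℂ X] [CompleteSpace X]
    [TopologicalSpace.SeparableSpace X] (hdim : ¬ FiniteDimensional ℂ X)
    (T : X →L[ℂ] X) (x₀ : X) (e : ℤ → X) (he0 : e 0 = x₀)
    (hTe : ∀ n : ℤ, T (e n) = e (n + 1))
    (hspan : Dense (Submodule.span ℂ (Set.range e) : Set X))
    (hsum : Summable (fun n : ℤ => e (-n))) :
    ∃ x : X, ∀ U : Set X, IsOpen U → U.Nonempty →
      0 < lowerDensity {n : ℕ | 1 ≤ n ∧ (T ^ n) x ∈ U} := by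
  have hsum' : Summable e := (Equiv.neg ℤ).summable_iff.1 hsum
  have hd (l : ℕ) : ∃ Y : ℤ → X, (∀ n, T (Y n) = Y (n + 1)) ∧ Summable Y ∧
      dist (TopologicalSpace.denseSeq X l.unpair.1) (Y 0) < 1 / ((l : ℝ) + 1) := by
    obtain ⟨y, hy, hdist⟩ := hspan.exists_dist_lt (TopologicalSpace.denseSeq X l.unpair.1)
      (Nat.one_div_pos_of_nat (α := ℝ) (n := l))
    obtain ⟨Y, rfl, hTY, hY⟩ := exists_summable_orbit_of_mem_span hTe hsum' hy
    exact ⟨Y, hTY, hY, hdist⟩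
  choose Y hTY hY hdist using hd
  obtain ⟨x, r, hx⟩ := exists_forall_norm_pow_sub_le T Y hTY hY
  refine ⟨x, fun U hU ⟨z, hz⟩ ↦ ?_⟩
  obtain ⟨ε, hε, hball⟩ := Metric.isOpen_iff.1 hU z hz
  have hε3 : 0 < ε / 3 := by positivity
  obtain ⟨a, ha⟩ := (TopologicalSpace.denseRange_denseSeq X).exists_dist_lt z hε3
  have h1 : ∀ᶠ l : ℕ in atTop, 1 / ((l : ℝ) + 1) < ε / 3 :=
    tendsto_one_div_add_atTop_nhds_zero_nat.eventually_lt_const hε3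
  have h2 : ∀ᶠ l : ℕ in atTop, 2 * (1 / 2 : ℝ) ^ l < ε / 3 := by
    have h := (tendsto_pow_atTop_nhds_zero_of_lt_one (r := (1 / 2 : ℝ)) (by norm_num)
      (by norm_num)).const_mul 2
    rw [mul_zero] at h
    exact h.eventually_lt_const hε3
  obtain ⟨b, hb⟩ := eventually_atTop.1 (h1.and h2)
  obtain ⟨hb1, hb2⟩ := hb (Nat.pair a b) (Nat.right_le_pair a b)
  refine lowerDensity_pos_of_spacedSet_subset (r := r (Nat.pair a b)) fun m hm ↦
    ⟨by have := lt_of_mem_spacedSet hm; lia, hball ?_⟩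
  have hm' := hx _ m hm
  have hY' := hdist (Nat.pair a b)
  rw [Nat.unpair_pair] at hY'
  rw [← dist_eq_norm] at hm'
  rw [Metric.mem_ball, dist_comm]
  have h3 := dist_triangle4 z (TopologicalSpace.denseSeq X a) (Y (Nat.pair a b) 0) ((T ^ m) x)
  rw [dist_comm (Y _ 0)] at h3
  linarith
end

section
/- Fix integers d ≥ 1 and p ≥ 1 such that 2^{s+1+p} ≥ 2^{s+1} + 2d + 1 for every s ≥ 1. With I_j^{(s)} = [2^{j+1} − 2^{j−s+1}, 2^{j+1} − 2^{j−s}), L_j^{(s)} = { i ∈ I_j^{(s)} : dist(i, ℕ∖I_j^{(s)}) ≥ 2^{s+1+p} and 2^{s+1+p} divides i }, J = 5ℕ ∪ (5ℕ+2), and D_s = ⋃_{j≥2s+p+2, j∈J} L_j^{(s)}, the following holds for every s ≥ 1: liminf_{n→∞} (1/n)·#(D_s∩[1,n]) ≥ (10/31)·2^{−2s−p−3}. In particular each D_s has positive lower density. -/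
open Filter Topology

/-- The interval `I_j^{(s)} = [2^{j+1} − 2^{j−s+1}, 2^{j+1} − 2^{j−s})` of natural numbers. -/
def Iset (s j : ℕ) : Set ℕ := Set.Ico (2 ^ (j + 1) - 2 ^ (j - s + 1)) (2 ^ (j + 1) - 2 ^ (j - s))

/-- `L_j^{(s)} = { i ∈ I_j^{(s)} : dist(i, ℕ∖I_j^{(s)}) ≥ 2^{s+1+p} and 2^{s+1+p} ∣ i }`. -/
def Lset (p s j : ℕ) : Set ℕ :=
  {i | i ∈ Iset s j ∧ (∀ m : ℕ, m ∉ Iset s j → (2 : ℤ) ^ (s + 1 + p) ≤ |(i : ℤ) - (m : ℤ)|) ∧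
    2 ^ (s + 1 + p) ∣ i}

/-- `Δ_s = ⋃_{j ≥ 2s+p+2} L_j^{(s)}`. -/
def Dlt (p s : ℕ) : Set ℕ := {i | ∃ j : ℕ, 2 * s + p + 2 ≤ j ∧ i ∈ Lset p s j}

/-- `D_s = ⋃_{j ≥ 2s+p+2, j ∈ J} L_j^{(s)}`, where `J = 5ℕ ∪ (5ℕ+2)`. -/
def Dset (p s : ℕ) : Set ℕ :=
  {i | ∃ j : ℕ, 2 * s + p + 2 ≤ j ∧ (j % 5 = 0 ∨ j % 5 = 2) ∧ i ∈ Lset p s j}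

/-- The right endpoint of `Iset s j`. -/
def rightEnd (s j : ℕ) : ℕ := 2 ^ (j + 1) - 2 ^ (j - s)

lemma rightEnd_le (s j : ℕ) : rightEnd s j ≤ 2 ^ (j + 1) := Nat.sub_le _ _

lemma two_pow_le_rightEnd (s j : ℕ) : 2 ^ j ≤ rightEnd s j := by
  have h : 2 ^ (j - s) ≤ 2 ^ j := Nat.pow_le_pow_right two_pos (Nat.sub_le _ _)
  rw [rightEnd, pow_succ]
  omega

lemma rightEnd_cast {s j : ℕ} (h : s ≤ j) :
    (rightEnd s j : ℝ) = 2 ^ (j + 1) * (1 - (2 ^ (s + 1))⁻¹) := by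
  obtain ⟨r, rfl⟩ := Nat.exists_eq_add_of_le h
  have hle : 2 ^ (s + r - s) ≤ 2 ^ (s + r + 1) := Nat.pow_le_pow_right two_pos (by omega)
  rw [rightEnd, Nat.cast_sub hle]
  push_cast
  rw [Nat.add_sub_cancel_left]
  field_simp
  ring

/-- The points of `Lset p s j` are the interior multiples of `2 ^ (s + 1 + p)` in `Iset s j`. -/
lemma add_mul_mem_Lset {p s r k : ℕ} (hk : 1 ≤ k) (hkr : k < 2 ^ r) :
    2 ^ (2 * s + p + 1 + r + 1) - 2 ^ (2 * s + p + 1 + r - s + 1) + k * 2 ^ (s + 1 + p) ∈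
      Lset p s (2 * s + p + 1 + r) := by
  have e₁ : 2 ^ (2 * s + p + 1 + r + 1) = 2 ^ (s + 1 + p) * (2 ^ (s + r + 1)) := by
    rw [← pow_add]; congr 1; ring
  have e₂ : 2 ^ (2 * s + p + 1 + r - s + 1) = 2 ^ (s + 1 + p) * (2 * 2 ^ r) := by
    rw [← pow_succ', ← pow_add]; congr 1; omega
  have e₃ : 2 ^ (2 * s + p + 1 + r - s) = 2 ^ (s + 1 + p) * 2 ^ r := by
    rw [← pow_add]; congr 1; omega
  have hM : 2 * 2 ^ r ≤ 2 ^ (s + r + 1) := by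
    rw [← pow_succ']; exact Nat.pow_le_pow_right two_pos (by omega)
  have hz : ((2 : ℤ) ^ (s + 1 + p)) = ((2 ^ (s + 1 + p) : ℕ) : ℤ) := by push_cast; rfl
  simp only [Lset, Iset, Set.mem_ofPred_eq, Set.mem_Ico, e₁, e₂, e₃, hz]
  generalize 2 ^ (s + 1 + p) = Q at *
  generalize 2 ^ (s + r + 1) = M at *
  generalize 2 ^ r = R at *
  obtain ⟨N, rfl⟩ := Nat.exists_eq_add_of_le hM
  have f₁ : Q * (2 * R + N) - Q * (2 * R) = Q * N := by rw [mul_add, Nat.add_sub_cancel_left]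
  have f₂ : Q * (2 * R + N) - Q * R = Q * N + Q * R := by
    rw [show Q * (2 * R + N) = Q * N + Q * R + Q * R by ring, Nat.add_sub_cancel]
  rw [f₁, f₂]
  obtain ⟨k, rfl⟩ := Nat.exists_eq_add_of_le hk
  obtain ⟨t, rfl⟩ := Nat.exists_eq_add_of_lt hkr
  have hQ : 0 < Q := by
    rcases Nat.eq_zero_or_pos Q with rfl | h
    · simp at e₁
    · exact h
  have g₁ : (1 + k) * Q = Q + k * Q := by ring
  have g₂ : Q * (1 + k + t + 1) = Q + k * Q + t * Q + Q := by ring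
  refine ⟨by omega, fun m hm => ?_, Dvd.intro (N + (1 + k)) (by ring)⟩
  have hkQ := Nat.zero_le (k * Q)
  have htQ := Nat.zero_le (t * Q)
  rw [g₁]
  rw [g₂] at hm
  generalize k * Q = x at *
  generalize t * Q = y at *
  generalize Q * N = z at *
  push_cast
  rw [le_abs]
  omega

/-- The number of elements of `A` in `[1, n]`. -/
noncomputable def countUpTo (A : Set ℕ) (n : ℕ) : ℕ := (A ∩ Set.Icc 1 n).ncard

lemma countUpTo_mono (A : Set ℕ) : Monotone (countUpTo A) := fun _ _ h =>
  Set.ncard_le_ncard (Set.inter_subset_inter_right _ (Set.Icc_subset_Icc_right h))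
    ((Set.finite_Icc _ _).inter_of_right _)

/-- Each admissible `j = 2 * s + p + 1 + r` contributes `2 ^ r - 1` points to `Dset p s`. -/
lemma countUpTo_add_le {p s r : ℕ} (hs : 1 ≤ s) (hr : 1 ≤ r)
    (hJ : (2 * s + p + 1 + r) % 5 = 0 ∨ (2 * s + p + 1 + r) % 5 = 2) :
    countUpTo (Dset p s) (2 ^ (2 * s + p + 1 + r)) + 2 ^ r ≤
      countUpTo (Dset p s) (rightEnd s (2 * s + p + 1 + r)) + 1 := by
  set j := 2 * s + p + 1 + r with hj
  set f : ℕ → ℕ := fun k => 2 ^ (j + 1) - 2 ^ (j - s + 1) + k * 2 ^ (s + 1 + p) with hf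
  have hinj : Function.Injective f := fun k l h =>
    Nat.eq_of_mul_eq_mul_right (pow_pos two_pos (s + 1 + p)) (Nat.add_left_cancel h)
  have hleft : 2 ^ j ≤ 2 ^ (j + 1) - 2 ^ (j - s + 1) := by
    have h : 2 ^ (j - s + 1) ≤ 2 ^ j := Nat.pow_le_pow_right two_pos (by omega)
    rw [pow_succ 2 j]
    omega
  have hpos := pow_pos (two_pos (α := ℕ)) j
  have hcard : (f '' Set.Ico 1 (2 ^ r)).ncard = 2 ^ r - 1 := by
    rw [Set.ncard_image_of_injective _ hinj, ← Finset.coe_Ico, Set.ncard_coe_finset, Nat.card_Ico]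
  have hdisj : Disjoint (Dset p s ∩ Set.Icc 1 (2 ^ j)) (f '' Set.Ico 1 (2 ^ r)) := by
    rw [Set.disjoint_left]
    rintro _ ⟨-, -, h⟩ ⟨k, hk, rfl⟩
    have : 0 < k * 2 ^ (s + 1 + p) := Nat.mul_pos hk.1 (pow_pos two_pos _)
    simp only [hf] at h
    omega
  have hsub : Dset p s ∩ Set.Icc 1 (2 ^ j) ∪ f '' Set.Ico 1 (2 ^ r) ⊆
      Dset p s ∩ Set.Icc 1 (rightEnd s j) := by
    refine Set.union_subset (Set.inter_subset_inter_right _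
      (Set.Icc_subset_Icc_right (two_pow_le_rightEnd s j))) ?_
    rintro _ ⟨k, hk, rfl⟩
    have hL := add_mul_mem_Lset (p := p) (s := s) hk.1 hk.2
    refine ⟨⟨j, by omega, hJ, hL⟩, ?_, hL.1.2.le⟩
    simp only [hf]
    omega
  have h := Set.ncard_le_ncard hsub ((Set.finite_Icc _ _).inter_of_right _)
  rw [Set.ncard_union_eq hdisj ((Set.finite_Icc _ _).inter_of_right _)
    ((Set.finite_Ico _ _).image _), hcard] at h
  have hr' := pow_pos (two_pos (α := ℕ)) r
  simp only [countUpTo]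
  omega

lemma countUpTo_rightEnd_add_le {p s i j : ℕ} (hs : 1 ≤ s) (hij : i < j)
    (hj : 2 * s + p + 2 ≤ j) (hJ : j % 5 = 0 ∨ j % 5 = 2) :
    (countUpTo (Dset p s) (rightEnd s i) : ℝ) + 2 ^ j / 2 ^ (2 * s + p + 1) ≤
      countUpTo (Dset p s) (rightEnd s j) + 1 := by
  obtain ⟨r, rfl⟩ : ∃ r, j = 2 * s + p + 1 + r := ⟨j - (2 * s + p + 1), by omega⟩
  have h₁ := countUpTo_add_le (r := r) hs (by omega) hJ
  have h₂ := countUpTo_mono (Dset p s)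
    ((rightEnd_le s i).trans (Nat.pow_le_pow_right two_pos hij))
  rw [pow_add, mul_div_cancel_left₀ _ (by positivity)]
  exact_mod_cast (Nat.add_le_add_right h₂ _).trans h₁

lemma exists_le_countUpTo_rightEnd (p s : ℕ) (hs : 1 ≤ s) :
    ∃ C : ℝ, ∀ k : ℕ, 2 * s + p + 1 ≤ k →
      5 / 31 * (2 ^ (5 * k + 5) / 2 ^ (2 * s + p + 1)) ≤
        (countUpTo (Dset p s) (rightEnd s (5 * k + 2)) : ℝ) + 2 * k + C := by
  refine ⟨5 / 31 * (2 ^ (5 * (2 * s + p + 1) + 5) / 2 ^ (2 * s + p + 1)), fun k hk => ?_⟩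
  induction k, hk using Nat.le_induction with
  | base => exact le_add_of_nonneg_left (by positivity)
  | succ k hk ih =>
    have h₁ := countUpTo_rightEnd_add_le (p := p) (i := 5 * k + 2) (j := 5 * k + 5) hs
      (by omega) (by omega) (by omega)
    have h₂ := countUpTo_rightEnd_add_le (p := p) (i := 5 * k + 5) (j := 5 * k + 7) hs
      (by omega) (by omega) (by omega)
    have e₁ : (2 : ℝ) ^ (5 * k + 7) / 2 ^ (2 * s + p + 1) =
        4 * (2 ^ (5 * k + 5) / 2 ^ (2 * s + p + 1)) := by ring
    have e₂ : (2 : ℝ) ^ (5 * (k + 1) + 5) / 2 ^ (2 * s + p + 1) =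
        32 * (2 ^ (5 * k + 5) / 2 ^ (2 * s + p + 1)) := by ring
    rw [e₁] at h₂
    rw [e₂, show 5 * (k + 1) + 2 = 5 * k + 7 by ring]
    push_cast
    linarith

lemma eventually_linear_le_exp (C : ℝ) {A : ℝ} (hA : 0 < A) :
    ∀ᶠ k : ℕ in atTop, 2 * (k : ℝ) + C ≤ A * 2 ^ (5 * k + 5) := by
  have h₁ := tendsto_pow_const_div_const_pow_of_one_lt 1 (r := (2 : ℝ)) one_lt_two
  have h₂ : ∀ᶠ k : ℕ in atTop, (k : ℝ) ^ 1 / 2 ^ k < A := h₁.eventually (gt_mem_nhds hA)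
  have h₃ : ∀ᶠ k : ℕ in atTop, C / A ≤ (k : ℝ) :=
    tendsto_natCast_atTop_atTop.eventually_ge_atTop _
  filter_upwards [h₂, h₃] with k hk hk'
  rw [pow_one, div_lt_iff₀ (by positivity)] at hk
  rw [div_le_iff₀ hA] at hk'
  have hlt : (k : ℝ) ≤ 2 ^ k := by exact_mod_cast Nat.lt_two_pow_self.le
  have hpow : (2 : ℝ) ^ (5 * k + 5) = 32 * (2 ^ k) ^ 5 := by rw [← pow_mul]; ring
  have hone : (1 : ℝ) ≤ 2 ^ k := one_le_pow₀ one_le_two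
  have h5 : (2 : ℝ) ^ k ≤ (2 ^ k) ^ 5 := le_self_pow₀ hone (by norm_num)
  have hAk : k * A ≤ A * 2 ^ k := by nlinarith
  have hA5 : A * 2 ^ k ≤ A * (2 ^ k) ^ 5 := by gcongr
  have hA0 : 0 < A * 2 ^ k := by positivity
  rw [hpow]
  linarith

/-- A point lies between two consecutive values of an unbounded sequence. -/
lemma exists_le_lt_succ {b : ℕ → ℕ} (hb : ∀ k, k ≤ b k) {K n : ℕ} (hn : b K ≤ n) :
    ∃ k, K ≤ k ∧ b k ≤ n ∧ n < b (k + 1) := by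
  by_contra! h
  have hle : ∀ k, K ≤ k → b k ≤ n := fun k hk => by
    induction k, hk using Nat.le_induction with
    | base => exact hn
    | succ k hk ih => exact h k hk ih
  have h₁ := hle (K + n + 1) (by omega)
  have h₂ := hb (K + n + 1)
  omega

lemma eventually_le_partialDensity_Dset (p s : ℕ) (hs : 1 ≤ s) :
    ∀ᶠ n : ℕ in atTop, (10 / 31) * ((2 : ℝ) ^ (2 * s + p + 3))⁻¹ ≤ partialDensity (Dset p s) n := by
  obtain ⟨C, hC⟩ := exists_le_countUpTo_rightEnd p s hs
  have hA : 0 < 5 / 31 * (2 ^ (s + 1) : ℝ)⁻¹ / 2 ^ (2 * s + p + 1) := by positivity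
  obtain ⟨K, hK⟩ := eventually_atTop.1 (eventually_linear_le_exp C hA)
  set K' := max K (2 * s + p + 1)
  filter_upwards [eventually_ge_atTop (rightEnd s (5 * K' + 2)),
    eventually_gt_atTop 0] with n hn hn₀
  obtain ⟨k, hk, hkn, hnk⟩ := exists_le_lt_succ (b := fun k => rightEnd s (5 * k + 2))
    (fun k => le_trans (le_trans (by omega) Nat.lt_two_pow_self.le) (two_pow_le_rightEnd s _)) hn
  have hkK : K ≤ k := (le_max_left _ _).trans hk
  have hke : 2 * s + p + 1 ≤ k := (le_max_right _ _).trans hk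
  have hcount := hC k hke
  have hsmall := hK k hkK
  have hpos : (0 : ℝ) < n := by exact_mod_cast hn₀
  rw [partialDensity, le_div_iff₀ hpos]
  change _ ≤ (countUpTo (Dset p s) n : ℝ)
  have hconst : (10 / 31) * ((2 : ℝ) ^ (2 * s + p + 3))⁻¹ =
      5 / 62 * ((2 : ℝ) ^ (2 * s + p + 1))⁻¹ := by
    rw [show 2 * s + p + 3 = 2 * s + p + 1 + 2 by ring, pow_add, mul_inv]
    ring
  rw [hconst]
  set T : ℝ := 2 ^ (5 * k + 5) / 2 ^ (2 * s + p + 1) with hT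
  have hT₀ : 0 < T := by positivity
  set δ : ℝ := (2 ^ (s + 1))⁻¹ with hδ
  have hδ₁ : δ ≤ 1 := inv_le_one_of_one_le₀ (one_le_pow₀ one_le_two)
  have hsmall' : 2 * (k : ℝ) + C ≤ 5 / 31 * (δ * T) := by
    refine hsmall.trans_eq ?_
    rw [hT]
    ring
  have hδT : δ * T ≤ T := mul_le_of_le_one_left hT₀.le hδ₁
  rcases lt_or_ge n (rightEnd s (5 * k + 5)) with hlt | hge
  · have hmono : (countUpTo (Dset p s) (rightEnd s (5 * k + 2)) : ℝ) ≤ countUpTo (Dset p s) n := by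
      exact_mod_cast countUpTo_mono _ hkn
    have hnT : 5 / 62 * ((2 : ℝ) ^ (2 * s + p + 1))⁻¹ * n ≤ 5 / 31 * (T * (1 - δ)) := by
      have : (n : ℝ) ≤ 2 ^ (5 * k + 5 + 1) * (1 - δ) := by
        rw [← rightEnd_cast (by omega)]
        exact_mod_cast hlt.le
      calc _ ≤ 5 / 62 * ((2 : ℝ) ^ (2 * s + p + 1))⁻¹ * (2 ^ (5 * k + 5 + 1) * (1 - δ)) := by gcongr
        _ = _ := by rw [hT]; ring
    linarith
  · have hmono : (countUpTo (Dset p s) (rightEnd s (5 * k + 5)) : ℝ) ≤ countUpTo (Dset p s) n := by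
      exact_mod_cast countUpTo_mono _ hge
    have hstep := countUpTo_rightEnd_add_le (p := p) (i := 5 * k + 2) (j := 5 * k + 5) hs
      (by omega) (by omega) (by omega)
    have hnT : 5 / 62 * ((2 : ℝ) ^ (2 * s + p + 1))⁻¹ * n ≤ 20 / 31 * T := by
      have : (n : ℝ) ≤ 2 ^ (5 * (k + 1) + 2 + 1) := by
        exact_mod_cast hnk.le.trans (rightEnd_le _ _)
      calc _ ≤ 5 / 62 * ((2 : ℝ) ^ (2 * s + p + 1))⁻¹ * 2 ^ (5 * (k + 1) + 2 + 1) := by gcongr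
        _ = _ := by rw [hT]; ring
    have hT₂ : 4 ≤ T := by
      rw [hT, le_div_iff₀ (by positivity), show (4 : ℝ) = 2 ^ 2 by norm_num, ← pow_add]
      exact pow_le_pow_right₀ one_le_two (by omega)
    linarith

lemma partialDensity_le_one (A : Set ℕ) (n : ℕ) : partialDensity A n ≤ 1 := by
  refine div_le_one_of_le₀ ?_ n.cast_nonneg
  have h := Set.ncard_le_ncard (Set.inter_subset_right (s := A)) (Set.finite_Icc 1 n)
  rw [← Finset.coe_Icc, Set.ncard_coe_finset, Nat.card_Icc, Finset.coe_Icc] at h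
  exact_mod_cast h

/-- For every `s ≥ 1`, `liminf_{n→∞} (1/n)·#(D_s∩[1,n]) ≥ (10/31)·2^{−2s−p−3}`; in particular
each `D_s` has positive lower density. -/
theorem stmt_13 (d p : ℕ) (hd : 1 ≤ d) (hp : 1 ≤ p)
    (hdp : ∀ s : ℕ, 1 ≤ s → 2 ^ (s + 1) + 2 * d + 1 ≤ 2 ^ (s + 1 + p)) :
    ∀ s : ℕ, 1 ≤ s →
      (10 / 31) * ((2 : ℝ) ^ (2 * s + p + 3))⁻¹ ≤ lowerDensity (Dset p s) ∧
      0 < lowerDensity (Dset p s) := by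
  intro s hs
  have h : (10 / 31) * ((2 : ℝ) ^ (2 * s + p + 3))⁻¹ ≤ lowerDensity (Dset p s) :=
    le_liminf_of_le (isCoboundedUnder_ge_of_le atTop (partialDensity_le_one _))
      (eventually_le_partialDensity_Dset p s hs)
  exact ⟨h, lt_of_lt_of_le (by positivity) h⟩
end

section
/- Fix integers d ≥ 1 and p ≥ 1 such that 2^{s+1+p} ≥ 2^{s+1} + 2d + 1 for every s ≥ 1. With I_j^{(s)} = [2^{j+1} − 2^{j−s+1}, 2^{j+1} − 2^{j−s}), L_j^{(s)} = { i ∈ I_j^{(s)} : dist(i, ℕ∖I_j^{(s)}) ≥ 2^{s+1+p} and 2^{s+1+p} divides i }, J = 5ℕ ∪ (5ℕ+2), and D_s = ⋃_{j≥2s+p+2, j∈J} L_j^{(s)}, the following holds: for every s ≥ 1 and every n ≥ 1, (1/n)·#(D_s∩[1,n]) ≤ (64/31)·2^{−2s−p−1}. In particular Σ_{s≥1} 2^s · sup_{n≥1}(1/n)·#(D_s∩[1,n]) < ∞. -/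
open Filter Topology

/-- The set `L_j^{(s)}` is covered by an arithmetic progression of length `2^{j-2s-p-1}`. -/
lemma Lset_subset_image (p s j : ℕ) (hj : 2 * s + p + 2 ≤ j) :
    Lset p s j ⊆ ((Finset.range (2 ^ (j - (2 * s + p + 1)))).image
      fun t => 2 ^ (j + 1) - 2 ^ (j - s + 1) + 2 ^ (s + 1 + p) * t : Finset ℕ) := by
  rintro i ⟨⟨h1, h2⟩, -, h3⟩
  have hM : 2 ^ (s + 1 + p) ∣ 2 ^ (j + 1) - 2 ^ (j - s + 1) :=
    Nat.dvd_sub (pow_dvd_pow 2 (by omega)) (pow_dvd_pow 2 (by omega))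
  obtain ⟨t, ht⟩ := Nat.dvd_sub h3 hM
  have hlen : 2 ^ (j - s) = 2 ^ (s + 1 + p) * 2 ^ (j - (2 * s + p + 1)) := by
    rw [← pow_add]
    congr 1
    omega
  have hle : 2 ^ (j - s + 1) ≤ 2 ^ (j + 1) := Nat.pow_le_pow_right (by norm_num) (by omega)
  have hsucc : 2 ^ (j - s + 1) = 2 * 2 ^ (j - s) := pow_succ' _ _
  simp only [Finset.coe_image, Set.mem_image, Finset.mem_coe, Finset.mem_range]
  refine ⟨t, ?_, by omega⟩
  have : 2 ^ (s + 1 + p) * t < 2 ^ (s + 1 + p) * 2 ^ (j - (2 * s + p + 1)) := by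
    rw [← hlen, ← ht]
    omega
  exact lt_of_mul_lt_mul_left this (Nat.zero_le _)

/-- Elements of `I_j^{(s)}` are at least `2^j` when `1 ≤ s ≤ j`. -/
lemma two_pow_le_of_mem_Iset {s j i : ℕ} (hs : 1 ≤ s) (hsj : s ≤ j) (hi : i ∈ Iset s j) :
    2 ^ j ≤ i := by
  have h1 := hi.1
  have h2 : 2 ^ (j - s + 1) ≤ 2 ^ j := Nat.pow_le_pow_right (by norm_num) (by omega)
  have h3 : 2 ^ (j + 1) = 2 * 2 ^ j := pow_succ' _ _
  omega

lemma ncard_Dset_inter_Icc_mul_le (p s n : ℕ) (hs : 1 ≤ s) (hn : 1 ≤ n) :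
    (Dset p s ∩ Set.Icc 1 n).ncard * 2 ^ (2 * s + p + 1) ≤ 2 * n := by
  set J := (Finset.range (Nat.log 2 n + 1)).filter (2 * s + p + 2 ≤ ·)
  let F : Finset ℕ := J.biUnion fun j => (Finset.range (2 ^ (j - (2 * s + p + 1)))).image
    fun t => 2 ^ (j + 1) - 2 ^ (j - s + 1) + 2 ^ (s + 1 + p) * t
  have hsub : Dset p s ∩ Set.Icc 1 n ⊆ F := by
    rintro i ⟨⟨j, hj, -, hi⟩, -, hin⟩
    have hji : 2 ^ j ≤ i := two_pow_le_of_mem_Iset hs (by omega) hi.1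
    have hlog : j ≤ Nat.log 2 n := Nat.le_log_of_pow_le (by norm_num) (hji.trans hin)
    exact Finset.mem_coe.2 <| Finset.mem_biUnion.2
      ⟨j, Finset.mem_filter.2 ⟨Finset.mem_range.2 (by omega), hj⟩, Lset_subset_image p s j hj hi⟩
  have hcard : (Dset p s ∩ Set.Icc 1 n).ncard ≤ ∑ j ∈ J, 2 ^ (j - (2 * s + p + 1)) :=
    calc (Dset p s ∩ Set.Icc 1 n).ncard
        ≤ F.card := by
          simpa only [Set.ncard_coe_finset] using Set.ncard_le_ncard hsub F.finite_toSet
      _ ≤ _ := Finset.card_biUnion_le.trans <| Finset.sum_le_sum fun j _ =>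
          Finset.card_image_le.trans_eq (Finset.card_range _)
  calc (Dset p s ∩ Set.Icc 1 n).ncard * 2 ^ (2 * s + p + 1)
      ≤ (∑ j ∈ J, 2 ^ (j - (2 * s + p + 1))) * 2 ^ (2 * s + p + 1) := Nat.mul_le_mul_right _ hcard
    _ = ∑ j ∈ J, 2 ^ j := by
        rw [Finset.sum_mul]
        refine Finset.sum_congr rfl fun j hj => ?_
        have := (Finset.mem_filter.1 hj).2
        rw [← pow_add]
        congr 1
        omega
    _ ≤ ∑ j ∈ Finset.range (Nat.log 2 n + 1), 2 ^ j :=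
        Finset.sum_le_sum_of_subset (Finset.filter_subset _ _)
    _ ≤ 2 ^ (Nat.log 2 n + 1) := (Nat.geomSum_lt le_rfl fun _ => Finset.mem_range.1).le
    _ ≤ 2 * n := by
        rw [pow_succ']
        exact Nat.mul_le_mul_left 2 (Nat.pow_log_le_self 2 (by omega))

lemma partialDensity_Dset_le (p s n : ℕ) (hs : 1 ≤ s) (hn : 1 ≤ n) :
    partialDensity (Dset p s) n ≤ (64 / 31) * ((2 : ℝ) ^ (2 * s + p + 1))⁻¹ := by
  have h : ((Dset p s ∩ Set.Icc 1 n).ncard : ℝ) * 2 ^ (2 * s + p + 1) ≤ 2 * n := by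
    exact_mod_cast ncard_Dset_inter_Icc_mul_le p s n hs hn
  have hn' : (0 : ℝ) < n := by exact_mod_cast hn
  rw [partialDensity, ← div_eq_mul_inv, div_le_div_iff₀ hn' (by positivity)]
  linarith

lemma partialDensity_nonneg (A : Set ℕ) (n : ℕ) : 0 ≤ partialDensity A n := by
  unfold partialDensity
  positivity

/-- For every `s ≥ 1` and every `n ≥ 1`, `(1/n)·#(D_s∩[1,n]) ≤ (64/31)·2^{−2s−p−1}`; in
particular `∑_{s≥1} 2^s · sup_{n≥1} (1/n)·#(D_s∩[1,n]) < ∞`. -/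
theorem stmt_14 (d p : ℕ) (hd : 1 ≤ d) (hp : 1 ≤ p)
    (hdp : ∀ s : ℕ, 1 ≤ s → 2 ^ (s + 1) + 2 * d + 1 ≤ 2 ^ (s + 1 + p)) :
    (∀ s : ℕ, 1 ≤ s → ∀ n : ℕ, 1 ≤ n →
      partialDensity (Dset p s) n ≤ (64 / 31) * ((2 : ℝ) ^ (2 * s + p + 1))⁻¹) ∧
    Summable (fun s : ℕ =>
      (2 : ℝ) ^ s * ⨆ n : {n : ℕ // 1 ≤ n}, partialDensity (Dset p s) n) := by
  refine ⟨fun s hs n hn => partialDensity_Dset_le p s n hs hn, ?_⟩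
  rw [← summable_nat_add_iff 1]
  refine Summable.of_nonneg_of_le (fun s => ?_) (fun s => ?_)
    (summable_geometric_two.mul_left (64 / 31 : ℝ))
  · exact mul_nonneg (by positivity) (Real.iSup_nonneg fun n => partialDensity_nonneg _ _)
  · have : Nonempty {n : ℕ // 1 ≤ n} := ⟨⟨1, le_rfl⟩⟩
    have hsup : ⨆ n : {n : ℕ // 1 ≤ n}, partialDensity (Dset p (s + 1)) n ≤
        (64 / 31) * ((2 : ℝ) ^ (2 * (s + 1) + p + 1))⁻¹ :=
      ciSup_le fun n => partialDensity_Dset_le p (s + 1) n (by omega) n.2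
    have hpow : (2 : ℝ) ^ (s + 1) * ((2 : ℝ) ^ (2 * (s + 1) + p + 1))⁻¹ ≤ (1 / 2) ^ s := by
      rw [one_div_pow, ← div_eq_mul_inv, div_le_div_iff₀ (by positivity) (by positivity),
        ← pow_add, one_mul]
      exact pow_le_pow_right₀ (by norm_num) (by omega)
    calc _ ≤ (2 : ℝ) ^ (s + 1) * ((64 / 31) * ((2 : ℝ) ^ (2 * (s + 1) + p + 1))⁻¹) :=
          mul_le_mul_of_nonneg_left hsup (by positivity)
      _ = (64 / 31) * ((2 : ℝ) ^ (s + 1) * ((2 : ℝ) ^ (2 * (s + 1) + p + 1))⁻¹) := by ring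
      _ ≤ _ := mul_le_mul_of_nonneg_left hpow (by norm_num)
end
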